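/- Let A be an order-k real tensor with dimensions (d₁,…,d_k). If A is 0_{[k]}-orthogonal decomposable (i.e. A = Σ_{n=1}^r λ_n a₁^{(n)}⊗⋯⊗a_k^{(n)} with λ₁ ≥ ⋯ ≥ λ_r ≥ 0 and ⟨a_i^{(n)}, a_i^{(m)}⟩ = δ_{nm} for every mode i ∈ [k] and all n,m ∈ [r]), then for every partition π of [k] with π ≠ 1_{[k]}, ‖Unfold_π(A)‖_σ = ‖A‖_σ. -/

import Mathlib

open scoped BigOperators ENNReal

namespace TensorUnfolding

/-- The vector `l^p` norm of a finitely-indexed real vector, for `p ∈ [1, ∞]`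
(for `p = ∞` it is the maximum of the absolute values of the entries). -/
noncomputable def pNorm (p : ℝ≥0∞) {ι : Type} [Fintype ι] (x : ι → ℝ) : ℝ :=
  if p = ⊤ then ⨆ i, |x i| else (∑ i, |x i| ^ p.toReal) ^ (1 / p.toReal)

/-- `π` is a partition of `[k] = {0, …, k-1}`: a collection of disjoint nonempty
blocks whose union is all of `Fin k`. -/
def IsPartition {k : ℕ} (π : Finset (Finset (Fin k))) : Prop :=
  (∀ B ∈ π, B.Nonempty) ∧
  (∀ B ∈ π, ∀ B' ∈ π, B ≠ B' → Disjoint B B') ∧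
  π.sup id = Finset.univ

/-- `π₁ ≤ π₂`: every block of `π₁` is contained in some block of `π₂`. -/
def Refines {k : ℕ} (π₁ π₂ : Finset (Finset (Fin k))) : Prop :=
  ∀ B ∈ π₁, ∃ B' ∈ π₂, B ⊆ B'

/-- The finest partition `0_{[k]} = {{1}, …, {k}}`. -/
def botPartition (k : ℕ) : Finset (Finset (Fin k)) :=
  Finset.univ.image fun n => {n}

/-- The coarsest (one-block) partition `1_{[k]} = {[k]}`. -/
def topPartition (k : ℕ) : Finset (Finset (Fin k)) :=
  {Finset.univ}

/-- The meet `π₁ ∧ π₂`: the partition whose blocks are the nonempty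
intersections `B ∩ B'` with `B ∈ π₁`, `B' ∈ π₂`. -/
def meetPartition {k : ℕ} (π₁ π₂ : Finset (Finset (Fin k))) : Finset (Finset (Fin k)) :=
  ((π₁ ×ˢ π₂).image fun p => p.1 ∩ p.2).filter fun B => B.Nonempty

/-- The `l^p` operator norm of the unfolding of the tensor `A` induced by the
partition `π`: the supremum of `⟨A, ⊗_{B ∈ π} y_B⟩` over choices, for each block
`B ∈ π`, of a vector `y_B` indexed by `Π_{j ∈ B} Fin (d j)` with `l^p` norm 1. -/
noncomputable def unfoldNormP {k : ℕ} (p : ℝ≥0∞) (d : Fin k → ℕ)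
    (A : ((n : Fin k) → Fin (d n)) → ℝ) (π : Finset (Finset (Fin k))) : ℝ :=
  sSup { r : ℝ |
    ∃ y : (B : Finset (Fin k)) → ((j : B) → Fin (d j.1)) → ℝ,
      (∀ B ∈ π, pNorm p (y B) = 1) ∧
      r = ∑ i : (n : Fin k) → Fin (d n), A i * ∏ B ∈ π, y B fun j => i j.1 }

/-- The spectral norm of the unfolding of the tensor `A` induced by the
partition `π`: the supremum of `⟨A, ⊗_{B ∈ π} y_B⟩` over choices, for each block
`B ∈ π`, of a vector `y_B` indexed by `Π_{j ∈ B} Fin (d j)` with Euclidean norm 1. -/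
noncomputable def unfoldNorm {k : ℕ} (d : Fin k → ℕ)
    (A : ((n : Fin k) → Fin (d n)) → ℝ) (π : Finset (Finset (Fin k))) : ℝ :=
  sSup { r : ℝ |
    ∃ y : (B : Finset (Fin k)) → ((j : B) → Fin (d j.1)) → ℝ,
      (∀ B ∈ π, ∑ v, (y B v) ^ 2 = 1) ∧
      r = ∑ i : (n : Fin k) → Fin (d n), A i * ∏ B ∈ π, y B fun j => i j.1 }

/-- The `l^p` operator norm of the tensor `A`:
`‖A‖_p = sup { A(x₁, …, x_k) : ‖x_n‖_p = 1 }`. -/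
noncomputable def opNormP {k : ℕ} (p : ℝ≥0∞) (d : Fin k → ℕ)
    (A : ((n : Fin k) → Fin (d n)) → ℝ) : ℝ :=
  sSup { r : ℝ | ∃ x : (n : Fin k) → Fin (d n) → ℝ,
    (∀ n, pNorm p (x n) = 1) ∧
    r = ∑ i : (n : Fin k) → Fin (d n), A i * ∏ n, x n (i n) }

/-- The spectral norm of the tensor `A`:
`‖A‖_σ = sup { A(x₁, …, x_k) : ‖x_n‖₂ = 1 }`. -/
noncomputable def specNorm {k : ℕ} (d : Fin k → ℕ)
    (A : ((n : Fin k) → Fin (d n)) → ℝ) : ℝ :=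
  sSup { r : ℝ | ∃ x : (n : Fin k) → Fin (d n) → ℝ,
    (∀ n, ∑ i, (x n i) ^ 2 = 1) ∧
    r = ∑ i : (n : Fin k) → Fin (d n), A i * ∏ n, x n (i n) }

/-- The Frobenius norm of the tensor `A`. -/
noncomputable def frobNorm {k : ℕ} (d : Fin k → ℕ)
    (A : ((n : Fin k) → Fin (d n)) → ℝ) : ℝ :=
  Real.sqrt (∑ i : (n : Fin k) → Fin (d n), (A i) ^ 2)

/-- `D_A(B, B') = Π_{n ∈ B ∩ B'} d_n` if `B ∩ B' ≠ ∅`, and `0` otherwise. -/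
def blockDim {k : ℕ} (d : Fin k → ℕ) (B B' : Finset (Fin k)) : ℕ :=
  if (B ∩ B').Nonempty then ∏ n ∈ B ∩ B', d n else 0

/-- `dim_A(π₁, π₂) = Π_{B ∈ π₁} max_{B' ∈ π₂} D_A(B, B')`. -/
def dimRel {k : ℕ} (d : Fin k → ℕ) (π₁ π₂ : Finset (Finset (Fin k))) : ℕ :=
  ∏ B ∈ π₁, π₂.sup fun B' => blockDim d B B'

/-- `A` is `π`-orthogonal decomposable: `A = Σ_{n=1}^r λ_n a₁⁽ⁿ⁾ ⊗ ⋯ ⊗ a_k⁽ⁿ⁾`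
with `λ₁ ≥ ⋯ ≥ λ_r ≥ 0` and `Π_{i ∈ B} ⟨a_i⁽ⁿ⁾, a_i⁽ᵐ⁾⟩ = δ_{nm}` for every
block `B ∈ π`. -/
def IsPiOD {k : ℕ} (d : Fin k → ℕ) (A : ((n : Fin k) → Fin (d n)) → ℝ)
    (π : Finset (Finset (Fin k))) : Prop :=
  ∃ (r : ℕ) (lam : Fin r → ℝ) (a : Fin r → (n : Fin k) → Fin (d n) → ℝ),
    Antitone lam ∧ (∀ n, 0 ≤ lam n) ∧
    (∀ i, A i = ∑ n, lam n * ∏ m, a n m (i m)) ∧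
    (∀ B ∈ π, ∀ n m : Fin r,
      (∏ j ∈ B, ∑ t, a n j t * a m j t) = if n = m then 1 else 0)

end TensorUnfolding

namespace TensorUnfolding

/-- The sum of a product of one-variable functions is the product of their sums. -/
lemma sum_prod_eq_prod_sum {ι : Type*} [Fintype ι] [DecidableEq ι] {κ : ι → Type*}
    [∀ n, Fintype (κ n)] (f : (n : ι) → κ n → ℝ) :
    ∑ i : (n : ι) → κ n, ∏ n, f n (i n) = ∏ n, ∑ t, f n t := by
  rw [Finset.prod_univ_sum, Fintype.piFinset_univ]

/-- Bessel's inequality for finite real vectors. -/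
lemma sum_sq_dot_le {ι κ : Type*} [Fintype ι] [Fintype κ] [DecidableEq ι]
    (u : ι → κ → ℝ) (hu : ∀ n m, ∑ v, u n v * u m v = if n = m then 1 else 0)
    (y : κ → ℝ) : ∑ n, (∑ v, u n v * y v) ^ 2 ≤ ∑ v, y v ^ 2 := by
  have ho : Orthonormal ℝ fun n => (WithLp.toLp 2 (u n) : EuclideanSpace ℝ κ) := by
    rw [orthonormal_iff_ite]
    intro n m
    simpa [PiLp.inner_apply, mul_comm] using hu n m
  have h := ho.sum_inner_products_le (WithLp.toLp 2 y) (s := Finset.univ)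
  simpa [PiLp.inner_apply, EuclideanSpace.norm_sq_eq, mul_comm] using h

/-- A weighted sum of products of at least two families in the `l²` unit ball is at most
the largest weight. -/
lemma sum_mul_prod_le {ι κ : Type*} [Fintype κ] [DecidableEq ι] {S : Finset ι}
    (hS : S.Nontrivial) (c : κ → ι → ℝ) (hc : ∀ B ∈ S, ∑ n, c n B ^ 2 ≤ 1)
    (lam : κ → ℝ) (h0 : ∀ n, 0 ≤ lam n) {L : ℝ} (hL0 : 0 ≤ L) (hL : ∀ n, lam n ≤ L) :
    ∑ n, lam n * ∏ B ∈ S, c n B ≤ L := by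
  obtain ⟨B₁, h₁, B₂, h₂, hne⟩ := hS
  have habs : ∀ n, ∀ B ∈ S, |c n B| ≤ 1 := fun n B hB => by
    rw [← sq_le_one_iff_abs_le_one]
    exact (Finset.single_le_sum (f := fun n => c n B ^ 2) (fun _ _ => sq_nonneg _)
      (Finset.mem_univ n)).trans (hc B hB)
  have hprod : ∀ n, ∏ B ∈ S, c n B ≤ (c n B₁ ^ 2 + c n B₂ ^ 2) / 2 := fun n => by
    have hsub : ({B₁, B₂} : Finset ι) ⊆ S := by
      intro B hB
      rcases Finset.mem_insert.1 hB with rfl | hB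
      · exact h₁
      · rwa [Finset.mem_singleton.1 hB]
    have hle : ∏ B ∈ S, |c n B| ≤ ∏ B ∈ {B₁, B₂}, |c n B| := by
      rw [← Finset.prod_sdiff hsub]
      refine mul_le_of_le_one_left (Finset.prod_nonneg fun _ _ => abs_nonneg _) ?_
      exact Finset.prod_le_one (fun _ _ => abs_nonneg _)
        fun B hB => habs n B (Finset.mem_sdiff.1 hB).1
    rw [Finset.prod_pair hne] at hle
    have h := le_abs_self (∏ B ∈ S, c n B)
    rw [Finset.abs_prod] at h
    nlinarith [sq_nonneg (|c n B₁| - |c n B₂|), sq_abs (c n B₁), sq_abs (c n B₂)]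
  calc ∑ n, lam n * ∏ B ∈ S, c n B
      ≤ ∑ n, L * ((c n B₁ ^ 2 + c n B₂ ^ 2) / 2) := Finset.sum_le_sum fun n _ =>
        (mul_le_mul_of_nonneg_left (hprod n) (h0 n)).trans
          (mul_le_mul_of_nonneg_right (hL n) (by positivity))
    _ = L * ((∑ n, c n B₁ ^ 2 + ∑ n, c n B₂ ^ 2) / 2) := by
        rw [← Finset.mul_sum, ← Finset.sum_div, Finset.sum_add_distrib]
    _ ≤ L := by nlinarith [hc B₁ h₁, hc B₂ h₂]

variable {k : ℕ} {π : Finset (Finset (Fin k))}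

lemma IsPartition.exists_mem (hπ : IsPartition π) (n : Fin k) : ∃ B ∈ π, n ∈ B := by
  have h : n ∈ π.sup id := hπ.2.2 ▸ Finset.mem_univ n
  simpa [Finset.mem_sup] using h

lemma IsPartition.eq_of_mem (hπ : IsPartition π) {B B' : Finset (Fin k)} (hB : B ∈ π)
    (hB' : B' ∈ π) {n : Fin k} (h : n ∈ B) (h' : n ∈ B') : B = B' := by
  by_contra hne
  exact Finset.disjoint_left.1 (hπ.2.1 B hB B' hB' hne) h h'

lemma IsPartition.nontrivial (hπ : IsPartition π) (htop : π ≠ topPartition k) (n : Fin k) :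
    π.Nontrivial := by
  obtain ⟨B, hB, -⟩ := hπ.exists_mem n
  by_contra h
  have hs : π = {B} := by
    refine Finset.eq_singleton_iff_unique_mem.2 ⟨hB, fun C hC => ?_⟩
    by_contra hne
    exact h ⟨C, hC, B, hB, hne⟩
  apply htop
  have hsup := hπ.2.2
  rw [hs, Finset.sup_singleton, id] at hsup
  rw [hs, hsup, topPartition]

lemma IsPartition.prod_prod (hπ : IsPartition π) (f : Fin k → ℝ) :
    ∏ B ∈ π, ∏ j : B, f j = ∏ n, f n := by
  have hU : (Finset.univ : Finset (Fin k)) = π.biUnion id := by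
    rw [← hπ.2.2, Finset.sup_eq_biUnion]
  rw [hU, Finset.prod_biUnion (t := id) fun B hB B' hB' hne => hπ.2.1 B hB B' hB' hne]
  exact Finset.prod_congr rfl fun B _ => Finset.prod_coe_sort B f

/-- The sum of a product of functions of the blocks of a multi-index factors over the
blocks. -/
lemma IsPartition.sum_prod_restrict (hπ : IsPartition π) {d : Fin k → ℕ}
    (f : (B : Finset (Fin k)) → ((j : B) → Fin (d j.1)) → ℝ) :
    ∑ i : (n : Fin k) → Fin (d n), ∏ B ∈ π, f B (fun j => i j.1) =
      ∏ B ∈ π, ∑ v, f B v := by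
  rw [← Finset.prod_coe_sort π fun B => ∑ v, f B v,
    ← sum_prod_eq_prod_sum fun B : π => f B.1]
  refine Fintype.sum_bijective
    (fun (i : (n : Fin k) → Fin (d n)) (B : π) (j : B.1) => i j.1) ⟨?_, ?_⟩ _ _ ?_
  · intro i i' h
    funext n
    obtain ⟨B, hB, hn⟩ := hπ.exists_mem n
    exact congrFun (congrFun h ⟨B, hB⟩) ⟨n, hn⟩
  · intro g
    choose β hβ hmem using hπ.exists_mem
    refine ⟨fun n => g ⟨β n, hβ n⟩ ⟨n, hmem n⟩, ?_⟩
    funext ⟨B, hB⟩ ⟨n, hn⟩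
    obtain rfl := hπ.eq_of_mem hB (hβ n) hn (hmem n)
    rfl
  · intro i
    exact (Finset.prod_coe_sort π fun B => f B (fun j => i j.1)).symm

lemma sum_prod_mul_prod_eq_ite {ι : Type*} [Fintype ι] [DecidableEq ι] [Nonempty ι]
    {κ : ι → Type*} [∀ j, Fintype (κ j)] {r : ℕ} (a : Fin r → (j : ι) → κ j → ℝ)
    (ha : ∀ j n m, ∑ t, a n j t * a m j t = if n = m then 1 else 0) (n m : Fin r) :
    ∑ v : (j : ι) → κ j, (∏ j, a n j (v j)) * ∏ j, a m j (v j) =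
      if n = m then 1 else 0 := by
  simp_rw [← Finset.prod_mul_distrib]
  rw [sum_prod_eq_prod_sum fun j t => a n j t * a m j t]
  simp_rw [ha]
  split_ifs <;> simp

end TensorUnfolding

open TensorUnfolding in
/-- If `A` is `0_{[k]}`-orthogonal decomposable, i.e.
`A = Σ_{n=1}^r λ_n a₁⁽ⁿ⁾ ⊗ ⋯ ⊗ a_k⁽ⁿ⁾` with `λ₁ ≥ ⋯ ≥ λ_r ≥ 0` and
`⟨a_i⁽ⁿ⁾, a_i⁽ᵐ⁾⟩ = δ_{nm}` for every mode `i` and all `n, m`, then for every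
partition `π ≠ 1_{[k]}`, `‖Unfold_π(A)‖_σ = ‖A‖_σ`. -/
theorem zeroOD_norm_invariance {k : ℕ} (d : Fin k → ℕ) (hd : ∀ n, 1 ≤ d n)
    (A : ((n : Fin k) → Fin (d n)) → ℝ)
    (r : ℕ) (lam : Fin r → ℝ)
    (a : Fin r → (n : Fin k) → Fin (d n) → ℝ)
    (hmono : Antitone lam) (hnonneg : ∀ n, 0 ≤ lam n)
    (hA : ∀ i, A i = ∑ n, lam n * ∏ m, a n m (i m))
    (horth : ∀ i : Fin k, ∀ n m : Fin r,
      (∑ t, a n i t * a m i t) = if n = m then 1 else 0) :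
    ∀ π : Finset (Finset (Fin k)), IsPartition π → π ≠ topPartition k →
      unfoldNorm d A π = specNorm d A := by
  intro π hπ htop
  rcases isEmpty_or_nonempty (Fin k) with hk | ⟨⟨n₀⟩⟩
  · have hempty : π = ∅ := by
      refine Finset.eq_empty_of_forall_notMem fun B hB => ?_
      obtain ⟨n, -⟩ := hπ.1 B hB
      exact isEmptyElim n
    simp [unfoldNorm, specNorm, hempty]
  have : Nonempty (Fin k) := ⟨n₀⟩
  obtain ⟨L, hL0, hL, x₀, hx₀, hLx⟩ : ∃ L : ℝ, 0 ≤ L ∧ (∀ n, lam n ≤ L) ∧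
      ∃ x : (n : Fin k) → Fin (d n) → ℝ, (∀ n, ∑ i, (x n i) ^ 2 = 1) ∧
        L = ∑ i : (n : Fin k) → Fin (d n), A i * ∏ n, x n (i n) := by
    rcases r with _ | r
    · refine ⟨0, le_rfl, fun n => n.elim0, fun n => Pi.single ⟨0, hd n⟩ 1, fun n => ?_, ?_⟩
      · simp [Pi.single_apply, ite_pow]
      · simp [hA]
    · refine ⟨lam 0, hnonneg 0, fun n => hmono (Fin.zero_le n), a 0, fun n => ?_, ?_⟩
      · simpa [sq] using horth n 0 0
      · simp_rw [hA, Finset.sum_mul, mul_assoc]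
        rw [Finset.sum_comm]
        simp_rw [← Finset.mul_sum, sum_prod_mul_prod_eq_ite a horth]
        simp
  set U : Set ℝ := { r : ℝ |
    ∃ y : (B : Finset (Fin k)) → ((j : B) → Fin (d j.1)) → ℝ,
      (∀ B ∈ π, ∑ v, (y B v) ^ 2 = 1) ∧
      r = ∑ i : (n : Fin k) → Fin (d n), A i * ∏ B ∈ π, y B fun j => i j.1 }
  set S : Set ℝ := { r : ℝ | ∃ x : (n : Fin k) → Fin (d n) → ℝ,
    (∀ n, ∑ i, (x n i) ^ 2 = 1) ∧
    r = ∑ i : (n : Fin k) → Fin (d n), A i * ∏ n, x n (i n) }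
  have hSU : S ⊆ U := by
    rintro _ ⟨x, hx, rfl⟩
    refine ⟨fun B v => ∏ j : B, x j (v j), fun B _ => ?_, ?_⟩
    · simp_rw [← Finset.prod_pow]
      rw [sum_prod_eq_prod_sum fun (j : B) t => x j t ^ 2]
      simp [hx]
    · exact Finset.sum_congr rfl fun i _ => by
        rw [hπ.prod_prod fun n => x n (i n)]
  have hUL : L ∈ upperBounds U := by
    rintro _ ⟨y, hy, rfl⟩
    have hfactor : ∑ i : (n : Fin k) → Fin (d n), A i * ∏ B ∈ π, y B (fun j => i j.1) =
        ∑ n, lam n * ∏ B ∈ π, ∑ v, (∏ j : B, a n j (v j)) * y B v := by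
      simp_rw [hA, Finset.sum_mul, mul_assoc]
      rw [Finset.sum_comm]
      refine Finset.sum_congr rfl fun n _ => ?_
      rw [← Finset.mul_sum,
        ← hπ.sum_prod_restrict fun B v => (∏ j : B, a n j (v j)) * y B v]
      congr 1
      refine Finset.sum_congr rfl fun i _ => ?_
      rw [Finset.prod_mul_distrib, hπ.prod_prod fun m => a n m (i m)]
    rw [hfactor]
    refine sum_mul_prod_le (hπ.nontrivial htop n₀)
      (fun n B => ∑ v, (∏ j : B, a n j (v j)) * y B v) (fun B hB => ?_) lam hnonneg hL0 hL
    have : Nonempty B := (hπ.1 B hB).to_subtype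
    rw [← hy B hB]
    exact sum_sq_dot_le _ (sum_prod_mul_prod_eq_ite (fun n (j : B) => a n j)
      fun j => horth j) (y B)
  have hLS : L ∈ S := ⟨x₀, hx₀, hLx⟩
  exact (IsGreatest.csSup_eq ⟨hSU hLS, hUL⟩).trans
    (IsGreatest.csSup_eq ⟨hLS, fun _ h => hUL (hSU h)⟩).symm
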